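/- Let J₉(x,y) = −1 + 2·Re(j₉(x+iy, x−iy)) with j₉(u,v) = (9−27b)u³ − 9b·u⁶ − b·u⁹ + (27/2)uv − (9−54b)u⁴v + 9b·u⁷v − 27u²v² − 27b·u⁵v² + 15u³v³, b = exp(−iπ/3), and let f ∈ ℂ[x,y,z] be f = J₉(x,y) + z³(3 − 3z + z²)³. Then the complex vector space ℂ[x,y,z]/⟨f, ∂f/∂x, ∂f/∂y, ∂f/∂z⟩ has dimension 254, i.e. the total Tjurina number of f is 254. -/

import Mathlib

noncomputable section

/-- `bC = exp(-iπ/3)`. -/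
def bC : ℂ := Complex.exp (-((Real.pi : ℂ) / 3) * Complex.I)

/-- The polynomial `j9(u,v)`. -/
def j9 (u v : ℂ) : ℂ := (9 - 27*bC)*u^3 - 9*bC*u^6 - bC*u^9 + (27/2)*u*v - (9 - 54*bC)*u^4*v + 9*bC*u^7*v - 27*u^2*v^2 - 27*bC*u^5*v^2 + 15*u^3*v^3

/-- `j9(u,v)` plus its conjugate counterpart, minus one. -/
def Jfun {A : Type} [CommRing A] (b u v : A) : A := -1 + (9 - 27*b)*u^3 + (9 - 27*(1-b))*v^3 - 9*b*u^6 - 9*(1-b)*v^6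
  - b*u^9 - (1-b)*v^9 + 27*u*v - (9-54*b)*u^4*v - (9-54*(1-b))*v^4*u + 9*b*u^7*v + 9*(1-b)*v^7*u
  - 54*u^2*v^2 - 27*b*u^5*v^2 - 27*(1-b)*v^5*u^2 + 30*u^3*v^3

def Jufun {A : Type} [CommRing A] (b u v : A) : A := 3*(9 - 27*b)*u^2 - 54*b*u^5 - 9*b*u^8 + 27*v - 4*(9-54*b)*u^3*v
  - (9-54*(1-b))*v^4 + 63*b*u^6*v + 9*(1-b)*v^7 - 108*u*v^2 - 135*b*u^4*v^2
  - 54*(1-b)*v^5*u + 90*u^2*v^3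

theorem bC_conj_aux : bC = 1/2 - (Real.sqrt 3 / 2 : ℝ) * Complex.I := by
  unfold bC
  rw [show -((Real.pi : ℂ) / 3) * Complex.I = ((-(Real.pi/3) : ℝ) : ℂ) * Complex.I by push_cast; ring,
    Complex.exp_mul_I, ← Complex.ofReal_cos, ← Complex.ofReal_sin, Real.cos_neg, Real.sin_neg,
    Real.cos_pi_div_three, Real.sin_pi_div_three]
  push_cast; ring

theorem bC_sq : bC ^ 2 = bC - 1 := by
  rw [bC_conj_aux]
  have h : ((Real.sqrt 3 : ℝ) : ℂ)^2 = 3 := by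
    norm_cast; norm_num
  have hI := Complex.I_sq
  push_cast
  linear_combination (1/4 * Complex.I^2) * h + 3/4 * hI

theorem bC_conj : (starRingEnd ℂ) bC = 1 - bC := by
  rw [bC_conj_aux]
  simp only [map_sub, map_mul, Complex.conj_I, Complex.conj_ofReal, map_div₀, map_one, map_ofNat]
  ring

theorem J_re (x y : ℝ) : -1 + 2 * ((j9 ((x : ℂ) + (y : ℂ) * Complex.I)
          ((x : ℂ) - (y : ℂ) * Complex.I)).re : ℂ) =
      Jfun bC ((x : ℂ) + (y : ℂ) * Complex.I) ((x : ℂ) - (y : ℂ) * Complex.I) := by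
  have key : ∀ w : ℂ, 2 * (w.re : ℂ) = w + (starRingEnd ℂ) w := by
    intro w; rw [Complex.add_conj]; push_cast; ring
  rw [key]
  have h1 : (starRingEnd ℂ) ((x : ℂ) + (y : ℂ) * Complex.I) = (x : ℂ) - (y : ℂ) * Complex.I := by
    simp [sub_eq_add_neg]
  have h2 : (starRingEnd ℂ) ((x : ℂ) - (y : ℂ) * Complex.I) = (x : ℂ) + (y : ℂ) * Complex.I := by
    simp
  generalize (x : ℂ) + (y : ℂ) * Complex.I = u at *
  generalize (x : ℂ) - (y : ℂ) * Complex.I = v at *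
  unfold j9 Jfun
  simp only [map_sub, map_add, map_mul, map_pow, h1, h2, bC_conj, map_div₀, map_ofNat]
  ring

/-- Value of `J` in terms of roots `t₁,t₂,t₃` (`a = t₁+t₂`, `m = t₁t₂`, `t = t₃`). -/
theorem Jfun_val (b x y t : ℂ) (h : x * y * t = 1) :
    Jfun b (x + y + t) (x*y + (x+y)*t) =
      2 - b * (x^9 + y^9 + t^9) - (1-b) * ((x*y)^9 + (x*t)^9 + (y*t)^9) := by
  have hm : x * y ≠ 0 := by rintro h0; simp [h0] at h
  have ht : t = (x*y)⁻¹ := eq_inv_of_mul_eq_one_right h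
  have hp : x^9 + y^9 = 9*(x+y)*(x*y)^4 - 30*(x+y)^3*(x*y)^3 + 27 * (x+y)^5*(x*y)^2
    - 9 * (x+y)^7*(x*y) + (x+y)^9 := by ring
  have e : (x*y)^9 + (x*t)^9 + (y*t)^9 = (x*y)^9 + (x^9 + y^9)*t^9 := by ring
  rw [e, hp]
  generalize x*y = m at *
  generalize x+y = a at *
  subst ht
  unfold Jfun
  field_simp
  ring

theorem Jfun_crit (b x y t : ℂ) (h : x * y * t = 1) :
    (x - y) * (Jufun b (x + y + t) (x*y + (x+y)*t) + t * Jufun (1-b) (x*y + (x+y)*t) (x + y + t)) =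
      - 9 * (x^9 - y^9) * (b + (1-b) * t^9) := by
  have hm : x * y ≠ 0 := by rintro h0; simp [h0] at h
  have ht : t = (x*y)⁻¹ := eq_inv_of_mul_eq_one_right h
  have hp : x^9 - y^9 = (x - y) * ((x*y)^4 - 10*(x+y)^2*(x*y)^3 + 15 * (x+y)^4*(x*y)^2
    - 7 * (x+y)^6*(x*y) + (x+y)^8) := by ring
  rw [hp]
  generalize x-y = d at *
  generalize x*y = m at *
  generalize x+y = a at *
  subst ht
  rw [show -9 * (d * (m ^ 4 - 10 * a ^ 2 * m ^ 3 + 15 * a ^ 4 * m ^ 2 - 7 * a ^ 6 * m + a ^ 8)) * (b + (1 - b) * (m⁻¹) ^ 9)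
    = d * (-9 * ((m ^ 4 - 10 * a ^ 2 * m ^ 3 + 15 * a ^ 4 * m ^ 2 - 7 * a ^ 6 * m + a ^ 8)) * (b + (1 - b) * (m⁻¹) ^ 9)) by ring]
  congr 1
  unfold Jufun
  field_simp
  ring

open Polynomial in
theorem abstract_dim {R P : Type} [CommRing R] [Algebra ℂ R] [Fintype P] [DecidableEq P]
    (φ : P → R →ₐ[ℂ] ℂ) (N : Ideal R) (hN : ∀ r, r ∈ N ↔ ∀ p, φ p r = 0)
    (l : P → R) (hl : ∀ p q, φ q (l p) = if p = q then 1 else 0) (j : R) (G G' : ℂ[X])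
    (d : P → ℂ[X]) (h0 : ∀ p, d p ≠ 0) (h1 : ∀ p, d p ∣ G') (h2 : ∀ p, d p ∣ G + C (φ p j))
    (h3 : ∀ p, ∃ α β, d p = α * G' + β * (G + C (φ p j)))
    (I : Ideal R[X]) (hN1 : N.map C ≤ I) (hG1 : C j + G.map (algebraMap ℂ R) ∈ I)
    (hG2 : G'.map (algebraMap ℂ R) ∈ I)
    (hI : I ≤ N.map C ⊔ Ideal.span {C j + G.map (algebraMap ℂ R), G'.map (algebraMap ℂ R)}) :
    Module.finrank ℂ (R[X] ⧸ I) = ∑ p, (d p).natDegree := by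
  have hmap : ∀ p (q : ℂ[X]), mapAlgHom (φ p) (q.map (algebraMap ℂ R)) = q := by
    intro p q
    rw [coe_mapAlgHom, Polynomial.map_map]
    have : ((φ p : R →+* ℂ).comp (algebraMap ℂ R)) = RingHom.id ℂ := by
      ext x; simp
    simp [this]
  have hNC : ∀ g : R[X], (∀ p, mapAlgHom (φ p) g = 0) → g ∈ N.map (C : R →+* R[X]) := by
    intro g hg
    rw [Ideal.mem_map_C_iff]
    intro n
    rw [hN]
    intro p
    have := congrArg (fun q => q.coeff n) (hg p)
    simpa using this
  have hNC' : ∀ g ∈ N.map (C : R →+* R[X]), ∀ p, mapAlgHom (φ p) g = 0 := by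
    intro g hg p
    rw [Ideal.mem_map_C_iff] at hg
    ext n
    have := (hN _).1 (hg n) p
    simpa using this
  let Θ : R[X] →ₐ[ℂ] (∀ p, ℂ[X] ⧸ Ideal.span {d p}) :=
    AlgHom.pi fun p => (Ideal.Quotient.mkₐ ℂ (Ideal.span {d p})).comp (mapAlgHom (φ p))
  have hΘ : ∀ g p, Θ g p = Ideal.Quotient.mk (Ideal.span {d p}) (mapAlgHom (φ p) g) := by
    intro g p; rfl
  -- interpolation
  have hint : ∀ (h : P → ℂ[X]) q,
      mapAlgHom (φ q) (∑ p, C (l p) * (h p).map (algebraMap ℂ R)) = h q := by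
    intro h q
    rw [map_sum, Finset.sum_eq_single q]
    · rw [map_mul, hmap]; simp [hl]
    · intro p _ hpq
      rw [map_mul, hmap]; simp [hl, hpq]
    · simp
  have hsurj : Function.Surjective Θ := by
    intro y
    choose h hh using fun p => Ideal.Quotient.mk_surjective (y p)
    refine ⟨∑ p, C (l p) * (h p).map (algebraMap ℂ R), ?_⟩
    funext q
    rw [hΘ, hint, hh]
  have hker : RingHom.ker Θ = I := by
    apply le_antisymm
    · intro g hg
      have hg' : ∀ p, d p ∣ mapAlgHom (φ p) g := by
        intro p
        have := congrFun (show Θ g = 0 from hg) p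
        rw [hΘ] at this
        exact Ideal.mem_span_singleton.1 (Ideal.Quotient.eq_zero_iff_mem.1 this)
      have hb : ∀ p, C (l p) * (d p).map (algebraMap ℂ R) ∈ I := by
        intro p
        obtain ⟨α, β, h⟩ := h3 p
        have e : C (l p) * (d p).map (algebraMap ℂ R) =
            (C (l p) * α.map (algebraMap ℂ R)) * G'.map (algebraMap ℂ R)
            + (C (l p) * β.map (algebraMap ℂ R)) * (C j + G.map (algebraMap ℂ R))
            + β.map (algebraMap ℂ R) * (C (l p * (algebraMap ℂ R (φ p j) - j))) := by
          rw [h]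
          simp only [Polynomial.map_add, Polynomial.map_mul, map_C, C_mul, C_sub]
          ring
        rw [e]
        refine I.add_mem (I.add_mem (I.mul_mem_left _ hG2) (I.mul_mem_left _ hG1))
          (I.mul_mem_left _ (hN1 (Ideal.mem_map_of_mem _ ?_)))
        rw [hN]
        intro q
        rw [map_mul, hl]
        split_ifs with hpq
        · subst hpq; simp
        · simp
      choose k hk using hg'
      have hdiff : g - ∑ p, C (l p) * (d p * k p).map (algebraMap ℂ R) ∈ I := by
        apply hN1
        apply hNC
        intro p
        rw [map_sub, hint (fun p => d p * k p), ← hk, sub_self]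
      have hs : ∑ p, C (l p) * (d p * k p).map (algebraMap ℂ R) ∈ I := by
        refine I.sum_mem fun p _ => ?_
        rw [Polynomial.map_mul, ← mul_assoc]
        exact I.mul_mem_right _ (hb p)
      simpa using I.add_mem hdiff hs
    · refine hI.trans (sup_le ?_ ?_)
      · intro g hg
        change Θ g = 0
        funext p
        rw [hΘ, hNC' g hg]; simp
      · rw [Ideal.span_le]
        rintro g (rfl | rfl)
        · change Θ _ = 0
          funext p
          rw [hΘ, map_add, hmap]
          apply Ideal.Quotient.eq_zero_iff_mem.2
          rw [Ideal.mem_span_singleton]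
          have := h2 p
          rw [add_comm] at this
          simpa using this
        · change Θ _ = 0
          funext p
          rw [hΘ, hmap]
          apply Ideal.Quotient.eq_zero_iff_mem.2
          rw [Ideal.mem_span_singleton]
          exact h1 p
  subst hker
  rw [(Ideal.quotientKerAlgEquivOfSurjective hsurj).toLinearEquiv.finrank_eq]
  have : ∀ p, Module.Finite ℂ (ℂ[X] ⧸ Ideal.span {d p}) := fun p =>
    (AdjoinRoot.powerBasis (h0 p)).finite
  rw [Module.finrank_pi_fintype]
  exact Finset.sum_congr rfl fun p _ => finrank_quotient_span_eq_natDegree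

open MvPolynomial in
/-- distinct points: evaluation is surjective; interpolants. -/
theorem interp {P : Type} [Fintype P] [DecidableEq P] (pt : P → Fin 2 → ℂ)
    (hinj : Function.Injective pt) :
    ∃ l : P → MvPolynomial (Fin 2) ℂ, ∀ p q, aeval (pt q) (l p) = if p = q then (1:ℂ) else 0 := by
  have : ∀ p q, p ≠ q → ∃ r : MvPolynomial (Fin 2) ℂ, aeval (pt p) r = (1:ℂ) ∧ aeval (pt q) r = (0:ℂ) := by
    intro p q hpq
    obtain ⟨i, hi⟩ : ∃ i, pt p i ≠ pt q i := by
      by_contra! h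
      exact hpq (hinj (funext h))
    have hi' : pt p i - pt q i ≠ 0 := sub_ne_zero.2 hi
    refine ⟨C (pt p i - pt q i)⁻¹ * (X i - C (pt q i)), ?_, ?_⟩
    · simp [hi']
    · simp
  choose! r hr1 hr2 using this
  refine ⟨fun p => ∏ q ∈ Finset.univ.erase p, r p q, ?_⟩
  intro p q
  rw [map_prod]
  split_ifs with h
  · subst h
    exact Finset.prod_eq_one fun q hq => hr1 p q (Finset.ne_of_mem_erase hq).symm
  · exact Finset.prod_eq_zero (Finset.mem_erase.2 ⟨Ne.symm h, Finset.mem_univ _⟩) (hr2 p q h)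

theorem map_Jfun {A B : Type} [CommRing A] [CommRing B] (φ : A →+* B) (b u v : A) :
    φ (Jfun b u v) = Jfun (φ b) (φ u) (φ v) := by
  simp [Jfun, map_ofNat]

theorem map_Jufun {A B : Type} [CommRing A] [CommRing B] (φ : A →+* B) (b u v : A) :
    φ (Jufun b u v) = Jufun (φ b) (φ u) (φ v) := by
  simp [Jufun, map_ofNat]

theorem deriv_Jfun {A : Type} [CommRing A] [Algebra ℂ A] (D : Derivation ℂ A A) (b u v : A)
    (hb : D b = 0) :
    D (Jfun b u v) = Jufun b u v * D u + Jufun (1 - b) v u * D v := by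
  have hn : ∀ n : ℕ, D (n : A) = 0 := fun n => D.map_natCast n
  have h3 := hn 3
  have h6 := hn 6
  have h9 := hn 9
  have h27 := hn 27
  have h30 := hn 30
  have h54 := hn 54
  push_cast at *
  simp only [Jfun, Jufun, map_add, map_sub, map_neg, Derivation.leibniz, Derivation.leibniz_pow, hb, h9, h27, h30,
    h54, Derivation.map_one_eq_zero, smul_eq_mul, nsmul_eq_mul]
  push_cast
  ring

/-- reduction step -/
theorem red_step {Q : Type} [CommRing Q] [Algebra ℂ Q] (S : Submodule ℂ Q) (b : ℂ)
    (hb : b ^ 2 = b - 1) (x y : Q) (h : Jufun (algebraMap ℂ Q b) x y = 0) (a c : ℕ)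
    (ih : ∀ i k, i + k < a + 8 + c → x ^ i * y ^ k ∈ S) : x ^ (a + 8) * y ^ c ∈ S := by
  have hb' : (algebraMap ℂ Q b) ^ 2 = algebraMap ℂ Q b - 1 := by
    rw [← map_pow, hb]; simp
  have h9 : algebraMap ℂ Q (1/9) * 9 = 1 := by
    rw [show (9 : Q) = algebraMap ℂ Q 9 from (map_ofNat _ 9).symm, ← map_mul]; norm_num
  have key : x ^ (a + 8) * y ^ c =
      ((1-b)*(3-9*b)) • (x^(a+2) * y^c) + (-(1-b)*6*b) • (x^(a+5) * y^c)
      + ((1-b)*3) • (x^a*y^(c+1)) + (-(1-b)*(4-24*b)) • (x^(a+3)*y^(c+1))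
      + (-(1-b)*(1-6*(1-b))) • (x^a*y^(c+4)) + ((1-b)*7*b) • (x^(a+6)*y^(c+1))
      + ((1-b)*(1-b)) • (x^a*y^(c+7)) + (-(1-b)*12) • (x^(a+1)*y^(c+2))
      + (-(1-b)*15*b) • (x^(a+4)*y^(c+2)) + (-(1-b)*6*(1-b)) • (x^(a+1)*y^(c+5))
      + ((1-b)*10) • (x^(a+2)*y^(c+3)) := by
    simp only [Algebra.smul_def, map_mul, map_sub, map_neg, map_one, map_ofNat]
    unfold Jufun at h
    generalize algebraMap ℂ Q b = B at *
    linear_combination (-(algebraMap ℂ Q (1/9)) * (1-B) * x^a*y^c) * h + x^a*y^c*x^8 * hb' +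
      (x^a*y^c*(1-B)*( (3 - 9*B)*x^2 - 6*B*x^5 - B*x^8 + 3*y - (4-24*B)*x^3*y
  - (1-6*(1-B))*y^4 + 7*B*x^6*y + (1-B)*y^7 - 12*x*y^2 - 15*B*x^4*y^2
  - 6*(1-B)*y^5*x + 10*x^2*y^3)) * h9
  rw [key]
  repeat' apply S.add_mem
  all_goals exact S.smul_mem _ (ih _ _ (by omega))

open MvPolynomial in
theorem ker_eq {P : Type} [Fintype P] [DecidableEq P] (hP : Fintype.card P = 64)
    (b : ℂ) (hb : b ^ 2 = b - 1)
    (pt : P → Fin 2 → ℂ) (hinj : Function.Injective pt)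
    (h1 : ∀ p, Jufun b (pt p 0) (pt p 1) = 0) (h2 : ∀ p, Jufun (1 - b) (pt p 1) (pt p 0) = 0)
    (r : MvPolynomial (Fin 2) ℂ) :
    r ∈ (Ideal.span {Jufun (C b) (X 0) (X 1), Jufun (1 - C b) (X 1) (X 0)} :
      Ideal (MvPolynomial (Fin 2) ℂ)) ↔ ∀ p, aeval (pt p) r = (0:ℂ) := by
  set N : Ideal (MvPolynomial (Fin 2) ℂ) :=
    Ideal.span {Jufun (C b) (X 0) (X 1), Jufun (1 - C b) (X 1) (X 0)} with hN
  have hle : ∀ p, ∀ r ∈ N, aeval (pt p) r = (0:ℂ) := by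
    intro p
    have : N ≤ RingHom.ker (aeval (pt p) : MvPolynomial (Fin 2) ℂ →ₐ[ℂ] ℂ) := by
      rw [hN, Ideal.span_le]
      rintro g (rfl | rfl)
      · change (aeval (pt p) : MvPolynomial (Fin 2) ℂ →ₐ[ℂ] ℂ).toRingHom _ = 0
        rw [map_Jufun]; simpa using h1 p
      · change (aeval (pt p) : MvPolynomial (Fin 2) ℂ →ₐ[ℂ] ℂ).toRingHom _ = 0
        rw [map_Jufun]; simpa using h2 p
    exact fun r hr => this hr
  refine ⟨fun hr p => hle p r hr, fun hr => ?_⟩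
  obtain ⟨l, hl⟩ := interp pt hinj
  let Q := MvPolynomial (Fin 2) ℂ ⧸ N
  let E : Q →ₐ[ℂ] (P → ℂ) :=
    AlgHom.pi fun p => Ideal.Quotient.liftₐ N (aeval (pt p)) (hle p)
  have hE : ∀ r p, E (Ideal.Quotient.mk N r) p = aeval (pt p) r := fun r p => rfl
  have hsurj : Function.Surjective E := by
    intro y
    refine ⟨Ideal.Quotient.mk N (∑ p, C (y p) * l p), ?_⟩
    funext q
    rw [hE, map_sum]
    simp only [map_mul, hl, algHom_C]
    simp
  let x : Q := Ideal.Quotient.mk N (X 0)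
  let y : Q := Ideal.Quotient.mk N (X 1)
  have hx : Jufun (algebraMap ℂ Q b) x y = 0 := by
    have : Ideal.Quotient.mk N (Jufun (C b) (X 0) (X 1)) = 0 :=
      Ideal.Quotient.eq_zero_iff_mem.2 (Ideal.subset_span (by simp))
    rwa [map_Jufun] at this
  have hy : Jufun (algebraMap ℂ Q (1 - b)) y x = 0 := by
    have : Ideal.Quotient.mk N (Jufun (1 - C b) (X 1) (X 0)) = 0 :=
      Ideal.Quotient.eq_zero_iff_mem.2 (Ideal.subset_span (by simp))
    rw [map_Jufun, map_sub, map_one] at this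
    rwa [map_sub, map_one]
  let m : Fin 8 × Fin 8 → Q := fun i => x ^ (i.1 : ℕ) * y ^ (i.2 : ℕ)
  have hmon : ∀ n a c, a + c = n → x ^ a * y ^ c ∈ Submodule.span ℂ (Set.range m) := by
    intro n
    induction n using Nat.strong_induction_on with
    | _ n ih =>
      intro a c hac
      by_cases ha : 8 ≤ a
      · obtain ⟨a, rfl⟩ := Nat.exists_eq_add_of_le' ha
        exact red_step _ b hb x y hx a c fun i k hik => ih (i + k) (by omega) i k rfl
      by_cases hc : 8 ≤ c
      · obtain ⟨c, rfl⟩ := Nat.exists_eq_add_of_le' hc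
        rw [mul_comm]
        refine red_step _ (1 - b) (by linear_combination hb) y x hy c a fun i k hik => ?_
        rw [mul_comm]
        exact ih (k + i) (by omega) k i rfl
      · exact Submodule.subset_span ⟨(⟨a, by omega⟩, ⟨c, by omega⟩), rfl⟩
  have htop : Submodule.span ℂ (Set.range m) = ⊤ := by
    rw [eq_top_iff]
    rintro q -
    obtain ⟨g, rfl⟩ := Ideal.Quotient.mk_surjective q
    induction g using MvPolynomial.induction_on' with
    | monomial s a =>
      have : (Ideal.Quotient.mk N (monomial s a) : Q) = a • (x ^ (s 0) * y ^ (s 1)) := by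
        rw [Algebra.smul_def a (x ^ (s 0) * y ^ (s 1)), monomial_eq, Finsupp.prod_fintype _ _ (by simp), Fin.prod_univ_two]
        simp only [map_mul, map_pow]
        rfl
      rw [this]
      exact Submodule.smul_mem _ _ (hmon _ _ _ rfl)
    | add p q hp hq => rw [map_add]; exact Submodule.add_mem _ hp hq
  have hfin : Module.Finite ℂ Q := ⟨(Submodule.fg_def).2 ⟨_, Set.finite_range m, htop⟩⟩
  have hcard : Module.finrank ℂ Q ≤ 64 := by
    have := finrank_range_le_card (R := ℂ) m
    rw [Set.finrank, htop, finrank_top] at this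
    simpa using this
  have hge : Module.finrank ℂ (P → ℂ) ≤ Module.finrank ℂ Q :=
    LinearMap.finrank_le_finrank_of_surjective (f := E.toLinearMap) hsurj
  have hPd : Module.finrank ℂ (P → ℂ) = 64 := by simp [hP]
  have hinjE : Function.Injective E.toLinearMap :=
    (LinearMap.injective_iff_surjective_of_finrank_eq_finrank (by omega)).2 hsurj
  have : (Ideal.Quotient.mk N r : Q) = 0 := by
    apply hinjE
    rw [map_zero]
    funext p
    exact hr p
  exact Ideal.Quotient.eq_zero_iff_mem.1 this

/-- Exponents of the roots `t₁,t₂,t₃` (as powers of a primitive 54th root of unity) of the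
64 critical points. -/
def ptsL : List (ℕ × ℕ × ℕ) := [
  (1, 7, 46), (1, 13, 40), (1, 19, 34), (1, 25, 28), (1, 31, 22), (1, 37, 16), (1, 43, 10), (1, 
  49, 4), (7, 13, 34), (7, 19, 28), (7, 25, 22), (7, 31, 16), (7, 37, 10), (7, 43, 4), (7, 49, 
  52), (13, 19, 22), (13, 25, 16), (13, 31, 10), (13, 37, 4), (13, 43, 52), (13, 49, 46), (19, 
  25, 10), (19, 31, 4), (19, 37, 52), (19, 43, 46), (19, 49, 40), (25, 31, 52), (25, 37, 46), 
  (25, 43, 40), (25, 49, 34), (31, 37, 40), (31, 43, 34), (31, 49, 28), (37, 43, 28), (37, 49, 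
  22), (43, 49, 16), (0, 6, 48), (0, 12, 42), (0, 18, 36), (0, 24, 30), (6, 12, 36), (6, 18, 30), 
  (12, 18, 24), (18, 42, 48), (24, 36, 48), (30, 36, 42), (2, 8, 44), (2, 14, 38), (2, 20, 32), 
  (8, 14, 32), (8, 20, 26), (14, 44, 50), (20, 38, 50), (26, 32, 50), (26, 38, 44), (4, 10, 40), 
  (4, 16, 34), (4, 22, 28), (10, 16, 28), (10, 46, 52), (16, 40, 52), (22, 34, 52), (22, 40, 46), 
  (28, 34, 46)]

def goodT (e : ℕ × ℕ × ℕ) : Prop :=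
  e.1 < e.2.1 ∧ e.2.1 < 54 ∧ e.2.2 < 54 ∧ (e.1 + e.2.1 + e.2.2) % 54 = 0 ∧
  ((e.1 % 6 = 1 ∧ e.2.1 % 6 = 1 ∧ e.2.2 % 6 = 4) ∨ (e.2.1 < e.2.2 ∧
    ((e.1 % 6 = 0 ∧ e.2.1 % 6 = 0 ∧ e.2.2 % 6 = 0) ∨
     (e.1 % 6 = 2 ∧ e.2.1 % 6 = 2 ∧ e.2.2 % 6 = 2) ∨
     (e.1 % 6 = 4 ∧ e.2.1 % 6 = 4 ∧ e.2.2 % 6 = 4))))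

instance : DecidablePred goodT := fun e => by unfold goodT; infer_instance

def expo (i : Fin 64) : ℕ × ℕ × ℕ := ptsL.getD i (0, 0, 0)

theorem expo_good : ∀ i, goodT (expo i) := by decide +kernel

theorem expo_inj : Function.Injective expo := by
  have : ∀ i j, expo i = expo j → i = j := by decide +kernel
  exact fun i j h => this i j h

/-- degree of the local contribution -/
def degT (e : ℕ × ℕ × ℕ) : ℕ := if e.1 % 6 = 1 then 6 else if e.1 % 6 = 4 then 0 else 2

theorem degT_sum : ∑ i, degT (expo i) = 254 := by decide +kernel

theorem goodT_ext {e e' : ℕ × ℕ × ℕ} (h : goodT e) (h' : goodT e')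
    (h1 : e'.1 = e.1 ∨ e'.1 = e.2.1 ∨ e'.1 = e.2.2)
    (h2 : e'.2.1 = e.1 ∨ e'.2.1 = e.2.1 ∨ e'.2.1 = e.2.2)
    (h3 : e'.2.2 = e.1 ∨ e'.2.2 = e.2.1 ∨ e'.2.2 = e.2.2) : e = e' := by
  obtain ⟨x, y, z⟩ := e
  obtain ⟨x', y', z'⟩ := e'
  simp only [goodT, Prod.mk.injEq] at *
  omega

def xi : ℂ := Complex.exp (2 * Real.pi * Complex.I / (54 : ℕ))

theorem xi_prim : IsPrimitiveRoot xi 54 := Complex.isPrimitiveRoot_exp 54 (by norm_num)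

theorem xi_nine : xi ^ 9 = 1 - bC := by
  have h : xi ^ 9 * bC = 1 := by
    unfold xi bC
    rw [← Complex.exp_nat_mul, ← Complex.exp_add]
    rw [show ((9 : ℕ) : ℂ) * (2 * Real.pi * Complex.I / (54 : ℕ)) +
      -((Real.pi : ℂ) / 3) * Complex.I = 0 by push_cast; ring, Complex.exp_zero]
  linear_combination (1 - bC) * h + xi ^ 9 * bC_sq

theorem xi_pow (n r : ℕ) (h : n % 6 = r) : (xi ^ n) ^ 9 = (1 - bC) ^ r := by
  have h54 : xi ^ 54 = 1 := xi_prim.pow_eq_one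
  have : n = 6 * (n / 6) + r := by omega
  rw [this, ← xi_nine]
  calc (xi ^ (6 * (n / 6) + r)) ^ 9 = (xi ^ 54) ^ (n / 6) * (xi ^ 9) ^ r := by
        rw [← pow_mul, ← pow_mul, ← pow_mul, ← pow_add]; congr 1; ring
    _ = _ := by rw [h54]; simp

def ptT (e : ℕ × ℕ × ℕ) : Fin 2 → ℂ :=
  ![xi ^ e.1 + xi ^ e.2.1 + xi ^ e.2.2,
    xi ^ e.1 * xi ^ e.2.1 + (xi ^ e.1 + xi ^ e.2.1) * xi ^ e.2.2]

theorem goodT_prod {e : ℕ × ℕ × ℕ} (h : goodT e) : xi ^ e.1 * xi ^ e.2.1 * xi ^ e.2.2 = 1 := by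
  rw [← pow_add, ← pow_add]
  exact (xi_prim.pow_eq_one_iff_dvd _).2 (Nat.dvd_of_mod_eq_zero h.2.2.2.1)

theorem xi_inj {a b : ℕ} (ha : a < 54) (hb : b < 54) (h : xi ^ a = xi ^ b) : a = b :=
  xi_prim.pow_inj ha hb h

theorem ptT_inj {e e' : ℕ × ℕ × ℕ} (h : goodT e) (h' : goodT e') (hp : ptT e = ptT e') :
    e = e' := by
  have hu : xi ^ e.1 + xi ^ e.2.1 + xi ^ e.2.2 = xi ^ e'.1 + xi ^ e'.2.1 + xi ^ e'.2.2 :=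
    congrFun hp 0
  have hv : xi ^ e.1 * xi ^ e.2.1 + (xi ^ e.1 + xi ^ e.2.1) * xi ^ e.2.2 =
    xi ^ e'.1 * xi ^ e'.2.1 + (xi ^ e'.1 + xi ^ e'.2.1) * xi ^ e'.2.2 := congrFun hp 1
  have hm := goodT_prod h
  have hm' := goodT_prod h'
  have key : ∀ t, (t - xi ^ e'.1) * (t - xi ^ e'.2.1) * (t - xi ^ e'.2.2) = 0 →
      t = xi ^ e.1 ∨ t = xi ^ e.2.1 ∨ t = xi ^ e.2.2 := by
    intro t ht
    have : (t - xi ^ e.1) * (t - xi ^ e.2.1) * (t - xi ^ e.2.2) = 0 := by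
      linear_combination ht - t^2 * hu + t * hv - hm + hm'
    rcases mul_eq_zero.1 this with h | h
    · rcases mul_eq_zero.1 h with h | h
      · left; exact sub_eq_zero.1 h
      · right; left; exact sub_eq_zero.1 h
    · right; right; exact sub_eq_zero.1 h
  have a1 : e.1 < 54 := h.1.trans h.2.1
  have a2 : e.2.1 < 54 := h.2.1
  have a3 : e.2.2 < 54 := h.2.2.1
  have b1 : e'.1 < 54 := h'.1.trans h'.2.1
  have b2 : e'.2.1 < 54 := h'.2.1
  have b3 : e'.2.2 < 54 := h'.2.2.1
  refine goodT_ext h h' ?_ ?_ ?_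
  · exact (key (xi ^ e'.1) (by ring)).imp (xi_inj b1 a1) (Or.imp (xi_inj b1 a2) (xi_inj b1 a3))
  · exact (key (xi ^ e'.2.1) (by ring)).imp (xi_inj b2 a1) (Or.imp (xi_inj b2 a2) (xi_inj b2 a3))
  · exact (key (xi ^ e'.2.2) (by ring)).imp (xi_inj b3 a1) (Or.imp (xi_inj b3 a2) (xi_inj b3 a3))

theorem crit_aux (b x y t : ℂ) (h : x * y * t = 1) (hxy : x ≠ y) (hyt : y ≠ t) (hxt : x ≠ t)
    (h1 : (x^9 - y^9) * (b + (1-b) * t^9) = 0) (h2 : (x^9 - t^9) * (b + (1-b) * y^9) = 0) :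
    Jufun b (x + y + t) (x*y + (x+y)*t) = 0 ∧ Jufun (1-b) (x*y + (x+y)*t) (x + y + t) = 0 := by
  have k1 := Jfun_crit b x y t h
  have k2 := Jfun_crit b x t y (by linear_combination h)
  rw [show x + t + y = x + y + t by ring, show x * t + (x + t) * y = x*y + (x+y)*t by ring] at k2
  generalize Jufun b (x + y + t) (x*y + (x+y)*t) = A at *
  generalize Jufun (1-b) (x*y + (x+y)*t) (x + y + t) = B at *
  have m1 : A + t * B = 0 := by
    have : (x - y) * (A + t * B) = 0 := by linear_combination k1 - 9 * h1
    exact (mul_eq_zero.1 this).resolve_left (sub_ne_zero.2 hxy)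
  have m2 : A + y * B = 0 := by
    have : (x - t) * (A + y * B) = 0 := by linear_combination k2 - 9 * h2
    exact (mul_eq_zero.1 this).resolve_left (sub_ne_zero.2 hxt)
  have hB : B = 0 := by
    have : (y - t) * B = 0 := by linear_combination m2 - m1
    exact (mul_eq_zero.1 this).resolve_left (sub_ne_zero.2 hyt)
  exact ⟨by linear_combination m1 - t * hB, hB⟩

theorem goodT_crit {e : ℕ × ℕ × ℕ} (h : goodT e) :
    Jufun bC (ptT e 0) (ptT e 1) = 0 ∧ Jufun (1 - bC) (ptT e 1) (ptT e 0) = 0 := by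
  have hb := bC_sq
  have a1 : e.1 < 54 := h.1.trans h.2.1
  have a2 : e.2.1 < 54 := h.2.1
  have a3 : e.2.2 < 54 := h.2.2.1
  refine crit_aux bC (xi ^ e.1) (xi ^ e.2.1) (xi ^ e.2.2) (goodT_prod h)
    (fun hh => ?_) (fun hh => ?_) (fun hh => ?_) ?_ ?_
  · have := xi_inj a1 a2 hh; have := h.1; omega
  · have := xi_inj a2 a3 hh
    obtain ⟨_, _, _, _, h | h⟩ := h <;> omega
  · have := xi_inj a1 a3 hh
    obtain ⟨_, _, _, _, h | h⟩ := h <;> omega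
  all_goals
    obtain ⟨_, _, _, _, ⟨g1, g2, g3⟩ | ⟨_, ⟨g1, g2, g3⟩ | ⟨g1, g2, g3⟩ | ⟨g1, g2, g3⟩⟩⟩ := h <;>
    rw [xi_pow _ _ g1, xi_pow _ _ g2, xi_pow _ _ g3] <;> try ring1
  linear_combination ((1 - bC) ^ 1 - (1 - bC) ^ 4) * hb

theorem goodT_val {e : ℕ × ℕ × ℕ} (h : goodT e) :
    (degT e = 6 ∧ Jfun bC (ptT e 0) (ptT e 1) = 0) ∨
    (degT e = 2 ∧ Jfun bC (ptT e 0) (ptT e 1) = -1) ∨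
    (degT e = 0 ∧ Jfun bC (ptT e 0) (ptT e 1) = 8) := by
  have hb := bC_sq
  have hv : Jfun bC (ptT e 0) (ptT e 1) = _ :=
    Jfun_val bC (xi ^ e.1) (xi ^ e.2.1) (xi ^ e.2.2) (goodT_prod h)
  simp only [mul_pow] at hv
  have b3 : bC ^ 3 = -1 := by linear_combination (bC + 1) * hb
  have c2 : (1 - bC) ^ 2 = -bC := by linear_combination hb
  have c4 : (1 - bC) ^ 4 = bC - 1 := by linear_combination ((1 - bC)^2 - bC + 1) * hb
  obtain ⟨_, _, _, _, ⟨g1, g2, g3⟩ | ⟨_, ⟨g1, g2, g3⟩ | ⟨g1, g2, g3⟩ | ⟨g1, g2, g3⟩⟩⟩ := h <;>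
    rw [xi_pow _ _ g1, xi_pow _ _ g2, xi_pow _ _ g3] at hv <;> rw [hv] <;> simp only [degT, g1]
  · left; refine ⟨by norm_num, ?_⟩
    rw [c4]
    linear_combination (3 - bC) * hb
  · right; left; refine ⟨by norm_num, ?_⟩
    ring
  · right; left; refine ⟨by norm_num, ?_⟩
    rw [c2]
    linear_combination (3 * bC + 3) * hb
  · right; right; refine ⟨by norm_num, ?_⟩
    rw [c4]
    linear_combination (3 * bC - 9) * hb

open Polynomial in
def qz : ℂ[X] := X * (3 - 3 * X + X ^ 2)

open Polynomial in
def Gz : ℂ[X] := X ^ 3 * (3 - 3 * X + X ^ 2) ^ 3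

open Polynomial in
def Gz' : ℂ[X] := 9 * (X * (3 - 3 * X + X ^ 2)) ^ 2 * (1 - X) ^ 2

open Polynomial in
def dT (n : ℕ) : ℂ[X] := if n = 6 then qz ^ 2 else if n = 2 then (1 - X) ^ 2 else 1

open Polynomial in
theorem dT_props (n : ℕ) (v : ℂ) (h : (n = 6 ∧ v = 0) ∨ (n = 2 ∧ v = -1) ∨ (n = 0 ∧ v = 8)) :
    dT n ≠ 0 ∧ dT n ∣ Gz' ∧ dT n ∣ Gz + C v ∧ (∃ α β, dT n = α * Gz' + β * (Gz + C v)) ∧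
      (dT n).natDegree = n := by
  have h9 : (C (1/9) : ℂ[X]) * 9 = 1 := by
    rw [show (9 : ℂ[X]) = C 9 from (map_ofNat C 9).symm, ← C_mul]; norm_num
  have h8 : (C (1/8) : ℂ[X]) * 8 = 1 := by
    rw [show (8 : ℂ[X]) = C 8 from (map_ofNat C 8).symm, ← C_mul]; norm_num
  have hq : qz.natDegree = 3 := by
    have : qz = X ^ 3 + C (-3) * X ^ 2 + C 3 * X + C 0 := by
      simp only [qz, map_neg, map_zero, map_ofNat]; ring
    rw [this]; compute_degree!
  have hq0 : qz ≠ 0 := by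
    intro h; rw [h] at hq; simp at hq
  have hw : (1 - X : ℂ[X]).natDegree = 1 := by
    compute_degree!
  have hw0 : (1 - X : ℂ[X]) ≠ 0 := by
    intro h; rw [h] at hw; simp at hw
  rcases h with ⟨rfl, rfl⟩ | ⟨rfl, rfl⟩ | ⟨rfl, rfl⟩
  · refine ⟨pow_ne_zero _ hq0, ⟨9 * (1 - X) ^ 2, ?_⟩, ⟨qz, ?_⟩,
      ⟨C (1/9) * (1 - X), 1, ?_⟩, ?_⟩
    · simp only [dT, if_true, Gz', qz]; ring
    · simp only [dT, if_true, Gz, qz, C_0]; ring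
    · simp only [dT, if_true, Gz, Gz', qz, C_0]
      linear_combination (-(X * (3 - 3 * X + X ^ 2)) ^ 2 * (1 - X) ^ 3) * h9
    · simp only [dT, if_true, natDegree_pow, hq]
  · have e : dT 2 = (1 - X) ^ 2 := by simp [dT]
    rw [e]
    refine ⟨pow_ne_zero _ hw0, ⟨9 * qz ^ 2, ?_⟩, ⟨(1 - X) * (-3 + 3 * (1 - X) ^ 3 - (1 - X) ^ 6), ?_⟩,
      ⟨C (1/9) * qz, - (1 - X) ^ 2, ?_⟩, ?_⟩
    · simp only [Gz', qz]; ring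
    · simp only [Gz, C_neg, C_1]; ring
    · simp only [Gz, Gz', qz, C_neg, C_1]
      linear_combination (-(X * (3 - 3 * X + X ^ 2)) ^ 3 * (1 - X) ^ 2) * h9
    · simp only [natDegree_pow, hw]
  · have e : dT 0 = 1 := by simp [dT]
    rw [e]
    refine ⟨one_ne_zero, one_dvd _, one_dvd _,
      ⟨- (C (1/8) * C (1/9) * C (1/9)) * ((1 - X) * (qz ^ 2 + qz - 8)),
        C (1/8) - C (1/8) * C (1/9) * qz ^ 2, ?_⟩, by simp⟩
    have hG : Gz = qz ^ 3 := by simp only [Gz, qz]; ring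
    have hG' : Gz' = 9 * qz ^ 2 * (1 - X) ^ 2 := rfl
    have hX : (1 - X : ℂ[X]) ^ 3 = 1 - qz := by simp only [qz]; ring
    rw [hG, hG', show (C 8 : ℂ[X]) = 8 from map_ofNat C 8]
    generalize (C (1/8) : ℂ[X]) = A at *
    generalize (C (1/9) : ℂ[X]) = B at *
    generalize (1 - X : ℂ[X]) = w at *
    generalize qz = q at *
    linear_combination (A * B * 9 * B * q ^ 2 * (q ^ 2 + q - 8)) * hX
      + (A * B * q ^ 2 * (q ^ 2 + q - 8) * (1 - q) + A * q ^ 3) * h9 - h8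

open MvPolynomial in
/-- Change of variables `x = (u+v)/2`, `y = (u-v)/(2i)`. -/
def toH : MvPolynomial (Fin 3) ℂ →ₐ[ℂ] Polynomial (MvPolynomial (Fin 2) ℂ) :=
  aeval ![Polynomial.C (C (1/2) * (X 0 + X 1)),
      Polynomial.C (C (-Complex.I/2) * (X 0 - X 1)), Polynomial.X]

open MvPolynomial in
def psi : MvPolynomial (Fin 2) ℂ →ₐ[ℂ] MvPolynomial (Fin 3) ℂ :=
  aeval ![X 0 + C Complex.I * X 1, X 0 - C Complex.I * X 1]

def fromH : Polynomial (MvPolynomial (Fin 2) ℂ) →ₐ[ℂ] MvPolynomial (Fin 3) ℂ :=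
  Polynomial.eval₂AlgHom psi (MvPolynomial.X 2) (fun _ => Commute.all _ _)

theorem fromH_X : fromH Polynomial.X = MvPolynomial.X 2 := Polynomial.eval₂_X _ _

theorem fromH_C (r : MvPolynomial (Fin 2) ℂ) : fromH (Polynomial.C r) = psi r :=
  Polynomial.eval₂_C _ _

open MvPolynomial in
theorem toH_C (a : ℂ) : toH (C a) = Polynomial.C (C a) := algHom_C toH a

open MvPolynomial in
theorem toH_X0 : toH (X 0) = Polynomial.C (C (1/2) * (X 0 + X 1)) := by
  simp [toH]

open MvPolynomial in
theorem toH_X1 : toH (X 1) = Polynomial.C (C (-Complex.I/2) * (X 0 - X 1)) := by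
  rw [toH, aeval_X]; rfl

open MvPolynomial in
theorem toH_X2 : toH (X 2) = Polynomial.X := by
  rw [toH, aeval_X]; rfl

open MvPolynomial in
theorem C_half (n : ℕ) : (C (1/2) : MvPolynomial (Fin n) ℂ) * 2 = 1 := by
  rw [show (2 : MvPolynomial (Fin n) ℂ) = C 2 from (map_ofNat C 2).symm, ← C_mul]; norm_num

open MvPolynomial in
theorem C_I (n : ℕ) : (C Complex.I : MvPolynomial (Fin n) ℂ) * C (-Complex.I/2) = C (1/2) := by
  rw [← C_mul]; congr 1; linear_combination (-1/2) * Complex.I_sq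

open MvPolynomial in
theorem toH_U : toH (X 0 + C Complex.I * X 1) = Polynomial.C (X 0) := by
  rw [map_add, map_mul, toH_C, toH_X0, toH_X1, ← Polynomial.C_mul, ← Polynomial.C_add]
  congr 1
  linear_combination (X 0 - X 1) * C_I 2 + X 0 * C_half 2

open MvPolynomial in
theorem toH_V : toH (X 0 - C Complex.I * X 1) = Polynomial.C (X 1) := by
  rw [map_sub, map_mul, toH_C, toH_X0, toH_X1, ← Polynomial.C_mul, ← Polynomial.C_sub]
  congr 1
  linear_combination -(X 0 - X 1) * C_I 2 + X 1 * C_half 2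

open MvPolynomial in
theorem psi_X0 : psi (X 0) = X 0 + C Complex.I * X 1 := by
  rw [psi, aeval_X]; rfl

open MvPolynomial in
theorem psi_X1 : psi (X 1) = X 0 - C Complex.I * X 1 := by
  rw [psi, aeval_X]; rfl

open MvPolynomial in
theorem toH_psi (r : MvPolynomial (Fin 2) ℂ) : toH (psi r) = Polynomial.C r := by
  have : toH.comp psi = Polynomial.CAlgHom := by
    apply MvPolynomial.algHom_ext
    intro i
    fin_cases i
    · change toH (psi (X 0)) = Polynomial.C (X 0)
      rw [psi_X0, toH_U]
    · change toH (psi (X 1)) = Polynomial.C (X 1)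
      rw [psi_X1, toH_V]
  exact congrArg (fun g => g r) this

open MvPolynomial in
def cv : MvPolynomial (Fin 3) ℂ ≃ₐ[ℂ] Polynomial (MvPolynomial (Fin 2) ℂ) :=
  AlgEquiv.ofAlgHom toH fromH
    (by
      apply Polynomial.algHom_ext'
      · ext1 r
        change toH (fromH (Polynomial.C (X r))) = Polynomial.C (X r)
        rw [fromH_C, toH_psi]
      · change toH (fromH Polynomial.X) = Polynomial.X
        rw [fromH_X, toH_X2])
    (by
      apply MvPolynomial.algHom_ext
      intro i
      have hC : ∀ a : ℂ, psi (C a) = C a := algHom_C psi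
      fin_cases i
      · change fromH (toH (X 0)) = X 0
        rw [toH_X0, fromH_C, map_mul, map_add, psi_X0, psi_X1, hC]
        linear_combination X 0 * C_half 3
      · change fromH (toH (X 1)) = X 1
        rw [toH_X1, fromH_C, map_mul, map_sub, psi_X0, psi_X1, hC]
        linear_combination X 1 * C_half 3 + 2 * X 1 * C_I 3
      · change fromH (toH (X 2)) = X 2
        rw [toH_X2, fromH_X])

open MvPolynomial in
theorem psi_Jfun : psi (Jfun (C bC) (X 0) (X 1)) =
    Jfun (C bC) (X 0 + C Complex.I * X 1) (X 0 - C Complex.I * X 1) := by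
  have := map_Jfun psi.toRingHom (C bC) (X 0) (X 1)
  have hC : psi (C bC) = C bC := algHom_C psi bC
  change psi _ = Jfun (psi _) (psi _) (psi _) at this
  rwa [hC, psi_X0, psi_X1] at this

open MvPolynomial in
theorem toH_Jufun (b : MvPolynomial (Fin 2) ℂ) (b' : MvPolynomial (Fin 3) ℂ)
    (hb : toH b' = Polynomial.C b) (u v : MvPolynomial (Fin 3) ℂ) (u' v' : MvPolynomial (Fin 2) ℂ)
    (hu : toH u = Polynomial.C u') (hv : toH v = Polynomial.C v') :
    toH (Jufun b' u v) = Polynomial.C (Jufun b u' v') := by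
  have h1 := map_Jufun toH.toRingHom b' u v
  change toH _ = Jufun (toH _) (toH _) (toH _) at h1
  rw [h1, map_Jufun, hb, hu, hv]

open MvPolynomial in
/-- The total Tjurina number of the nonic `f = J₉(x,y) + z³(3 - 3z + z²)³` is 254. -/
theorem stmt10 (J : MvPolynomial (Fin 3) ℂ)
    (hJ : ∀ x y z : ℝ,
      MvPolynomial.eval ![(x : ℂ), (y : ℂ), (z : ℂ)] J =
        -1 + 2 * ((j9 ((x : ℂ) + (y : ℂ) * Complex.I)
          ((x : ℂ) - (y : ℂ) * Complex.I)).re : ℂ))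
    (f : MvPolynomial (Fin 3) ℂ)
    (hf : f = J + X 2 ^ 3 * (C 3 - C 3 * X 2 + X 2 ^ 2) ^ 3) :
    Module.finrank ℂ
      (MvPolynomial (Fin 3) ℂ ⧸
        Ideal.span ({f, pderiv 0 f, pderiv 1 f, pderiv 2 f} :
          Set (MvPolynomial (Fin 3) ℂ))) = 254 := by
  set U : MvPolynomial (Fin 3) ℂ := X 0 + C Complex.I * X 1 with hU
  set V : MvPolynomial (Fin 3) ℂ := X 0 - C Complex.I * X 1 with hV
  -- identify J
  have hJ' : J = Jfun (C bC) U V := by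
    refine MvPolynomial.funext_set (fun _ => Set.range (fun x : ℝ => (x : ℂ)))
      (fun _ => Set.infinite_range_of_injective Complex.ofReal_injective) ?_
    intro p hp
    choose g hg using fun i => hp i (Set.mem_univ i)
    have hp' : p = ![(g 0 : ℂ), (g 1 : ℂ), (g 2 : ℂ)] := by
      funext i
      fin_cases i
      · exact (hg 0).symm
      · exact (hg 1).symm
      · exact (hg 2).symm
    rw [hp', hJ, J_re, map_Jfun]
    simp [hU, hV, mul_comm]
  have hC3 : (C 3 : MvPolynomial (Fin 3) ℂ) = 3 := map_ofNat C 3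
  rw [hC3] at hf
  have hb (i : Fin 3) : pderiv i (C bC : MvPolynomial (Fin 3) ℂ) = 0 := pderiv_C
  have h3 (i : Fin 3) : pderiv i (3 : MvPolynomial (Fin 3) ℂ) = 0 := by
    rw [← hC3]; exact pderiv_C
  have hdJ (i : Fin 3) := deriv_Jfun (pderiv i) (C bC) U V (hb i)
  have hf0 : pderiv 0 f = Jufun (C bC) U V + Jufun (1 - C bC) V U := by
    rw [hf, map_add, hJ', hdJ]
    simp [hU, hV, h3, pderiv_X, Derivation.leibniz, Derivation.leibniz_pow]
  have hf1 : pderiv 1 f = C Complex.I * (Jufun (C bC) U V - Jufun (1 - C bC) V U) := by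
    rw [hf, map_add, hJ', hdJ]
    simp [hU, hV, h3, pderiv_X, Derivation.leibniz, Derivation.leibniz_pow]
    ring
  have hf2 : pderiv 2 f = 9 * (X 2 * (3 - 3 * X 2 + X 2 ^ 2)) ^ 2 * (1 - X 2) ^ 2 := by
    rw [hf, map_add, hJ', hdJ]
    simp [hU, hV, h3, pderiv_X, Derivation.leibniz, Derivation.leibniz_pow]
    ring
  -- images
  set jj : MvPolynomial (Fin 2) ℂ := Jfun (C bC) (X 0) (X 1) with hjj
  set A : MvPolynomial (Fin 2) ℂ := Jufun (C bC) (X 0) (X 1) with hA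
  set B : MvPolynomial (Fin 2) ℂ := Jufun (1 - C bC) (X 1) (X 0) with hB
  have tA : toH (Jufun (C bC) U V) = Polynomial.C A :=
    toH_Jufun _ _ (toH_C _) _ _ _ _ toH_U toH_V
  have tB : toH (Jufun (1 - C bC) V U) = Polynomial.C B :=
    toH_Jufun _ _ (by rw [map_sub, map_one, toH_C, Polynomial.C_sub, Polynomial.C_1]) _ _ _ _
      toH_V toH_U
  have g0 : toH f = Polynomial.C jj + Gz.map (algebraMap ℂ _) := by
    rw [hf, hJ', map_add, ← psi_Jfun, toH_psi]
    simp [Gz, toH_X2, map_ofNat, hjj]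
  have g1 : toH (pderiv 0 f) = Polynomial.C A + Polynomial.C B := by
    rw [hf0, map_add, tA, tB]
  have g2 : toH (pderiv 1 f) = Polynomial.C (C Complex.I) * (Polynomial.C A - Polynomial.C B) := by
    rw [hf1, map_mul, map_sub, tA, tB, toH_C]
  have g3 : toH (pderiv 2 f) = Gz'.map (algebraMap ℂ _) := by
    rw [hf2]
    simp [Gz', toH_X2, map_ofNat]
  set I := Ideal.span ({f, pderiv 0 f, pderiv 1 f, pderiv 2 f} : Set (MvPolynomial (Fin 3) ℂ))
    with hI
  set I' := I.map (cv : MvPolynomial (Fin 3) ℂ →+* Polynomial (MvPolynomial (Fin 2) ℂ)) with hI'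
  have hmem : ∀ g ∈ I, toH g ∈ I' := fun g hg =>
    Ideal.mem_map_of_mem (cv : MvPolynomial (Fin 3) ℂ →+* Polynomial (MvPolynomial (Fin 2) ℂ)) hg
  rw [(Ideal.quotientEquivAlg I I' cv rfl).toLinearEquiv.finrank_eq]
  have m0 := hmem f (Ideal.subset_span (by simp))
  have m1 := hmem (pderiv 0 f) (Ideal.subset_span (by simp))
  have m2 := hmem (pderiv 1 f) (Ideal.subset_span (by simp))
  have m3 := hmem (pderiv 2 f) (Ideal.subset_span (by simp))
  rw [g0] at m0
  rw [g1] at m1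
  rw [g2] at m2
  rw [g3] at m3
  have hPI : (Polynomial.C (C Complex.I) : Polynomial (MvPolynomial (Fin 2) ℂ)) *
      Polynomial.C (C (-Complex.I/2)) = Polynomial.C (C (1/2)) := by
    rw [← Polynomial.C_mul, C_I]
  have hP2 : (Polynomial.C (C (1/2)) : Polynomial (MvPolynomial (Fin 2) ℂ)) * 2 = 1 := by
    rw [show (2 : Polynomial (MvPolynomial (Fin 2) ℂ)) = Polynomial.C 2 from
      (map_ofNat Polynomial.C 2).symm, ← Polynomial.C_mul, C_half, Polynomial.C_1]
  have mA : Polynomial.C A ∈ I' := by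
    have := I'.add_mem (I'.mul_mem_left (Polynomial.C (C (1/2))) m1)
      (I'.mul_mem_left (Polynomial.C (C (-Complex.I/2))) m2)
    convert! this using 1
    linear_combination -(Polynomial.C A - Polynomial.C B) * hPI - Polynomial.C A * hP2
  have mB : Polynomial.C B ∈ I' := by
    have := I'.sub_mem m1 mA
    simpa using this
  set N : Ideal (MvPolynomial (Fin 2) ℂ) := Ideal.span {A, B} with hN
  have hAN : A ∈ N := Ideal.subset_span (by simp)
  have hBN : B ∈ N := Ideal.subset_span (by simp)
  obtain ⟨l, hl⟩ := interp (fun i => ptT (expo i))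
    (fun i k h => expo_inj (ptT_inj (expo_good i) (expo_good k) h))
  have hval : ∀ i, aeval (ptT (expo i)) jj = Jfun bC (ptT (expo i) 0) (ptT (expo i) 1) := by
    intro i
    have := map_Jfun (aeval (ptT (expo i)) : MvPolynomial (Fin 2) ℂ →ₐ[ℂ] ℂ).toRingHom
      (C bC) (X 0) (X 1)
    simpa using this
  have hd : ∀ i, _ := fun i => dT_props (degT (expo i)) (aeval (ptT (expo i)) jj) (by
    rw [hval]; exact goodT_val (expo_good i))
  rw [abstract_dim (P := Fin 64) (fun i => aeval (ptT (expo i))) N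
    (ker_eq (by simp) bC bC_sq (fun i => ptT (expo i))
      (fun i k h => expo_inj (ptT_inj (expo_good i) (expo_good k) h))
      (fun i => (goodT_crit (expo_good i)).1) (fun i => (goodT_crit (expo_good i)).2))
    l hl jj Gz Gz' (fun i => dT (degT (expo i))) (fun i => (hd i).1) (fun i => (hd i).2.1)
    (fun i => (hd i).2.2.1) (fun i => (hd i).2.2.2.1) I' ?_ m0 m3 ?_]
  · rw [← degT_sum]
    exact Finset.sum_congr rfl fun i _ => (hd i).2.2.2.2
  · rw [hN, Ideal.map_span, Ideal.span_le]
    rintro _ ⟨g, (rfl | rfl), rfl⟩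
    · exact mA
    · exact mB
  · rw [hI', hI, Ideal.map_span, Ideal.span_le]
    have s1 : ∀ g ∈ N, Polynomial.C g ∈ N.map (Polynomial.C :
        MvPolynomial (Fin 2) ℂ →+* Polynomial (MvPolynomial (Fin 2) ℂ)) :=
      fun g hg => Ideal.mem_map_of_mem _ hg
    rintro _ ⟨g, (rfl | rfl | rfl | rfl), rfl⟩
    · change toH _ ∈ _
      rw [g0]
      exact Ideal.mem_sup_right (Ideal.subset_span (by simp))
    · change toH _ ∈ _
      rw [g1]
      exact Ideal.mem_sup_left (Ideal.add_mem _ (s1 _ hAN) (s1 _ hBN))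
    · change toH _ ∈ _
      rw [g2]
      exact Ideal.mem_sup_left (Ideal.mul_mem_left _ _ (Ideal.sub_mem _ (s1 _ hAN) (s1 _ hBN)))
    · change toH _ ∈ _
      rw [g3]
      exact Ideal.mem_sup_right (Ideal.subset_span (by simp))
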